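/- For n = 4, Q_3 = P_3 + (f), where f is the degree-4 polynomial f = −x_{14}x_{21}x_{33}x_{42} + x_{11}x_{23}x_{34}x_{42} + x_{14}x_{22}x_{31}x_{43} − x_{11}x_{22}x_{34}x_{43} − x_{12}x_{23}x_{31}x_{44} + x_{12}x_{21}x_{33}x_{44}; that is, Q_3 is generated by the four principal 3-minors of X together with f. -/

import Mathlib

open Matrix

/-- The generic `n × n` matrix whose entries are the variables `x i j` of the
polynomial ring `K[X]`. -/
noncomputable def genMat (K : Type*) [Field K] (n : ℕ) :
    Matrix (Fin n) (Fin n) (MvPolynomial (Fin n × Fin n) K) :=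
  fun i j => MvPolynomial.X (i, j)

/-- `P_t`: the ideal generated by the principal `t`-minors of the generic matrix,
i.e. the determinants of the submatrices whose rows and columns are both indexed by
a subset `s` of cardinality `t`. -/
noncomputable def prinMinorIdeal (K : Type*) [Field K] (n t : ℕ) :
    Ideal (MvPolynomial (Fin n × Fin n) K) :=
  Ideal.span {p | ∃ s : Finset (Fin n), s.card = t ∧
    p = ((genMat K n).submatrix (fun i : {x // x ∈ s} => (i : Fin n))
        (fun j : {x // x ∈ s} => (j : Fin n))).det}

/-- `Q_{n-1}`: the contraction to `S = K[X]` of the extension of `P_{n-1}` to the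
localization `S_Δ = S[1/Δ]`, where `Δ = det X`. -/
noncomputable def Qideal (K : Type*) [Field K] (n : ℕ) :
    Ideal (MvPolynomial (Fin n × Fin n) K) :=
  Ideal.comap (algebraMap (MvPolynomial (Fin n × Fin n) K)
      (Localization.Away (genMat K n).det))
    (Ideal.map (algebraMap (MvPolynomial (Fin n × Fin n) K)
      (Localization.Away (genMat K n).det)) (prinMinorIdeal K n (n - 1)))

/-- The degree-4 polynomial
`f = −x₁₄x₂₁x₃₃x₄₂ + x₁₁x₂₃x₃₄x₄₂ + x₁₄x₂₂x₃₁x₄₃ − x₁₁x₂₂x₃₄x₄₃ − x₁₂x₂₃x₃₁x₄₄ + x₁₂x₂₁x₃₃x₄₄`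
(indices written 1-based; here `Fin 4` is 0-based). -/
noncomputable def fpoly (K : Type*) [Field K] : MvPolynomial (Fin 4 × Fin 4) K :=
  - MvPolynomial.X ((0 : Fin 4), (3 : Fin 4)) * MvPolynomial.X (1, 0) *
      MvPolynomial.X (2, 2) * MvPolynomial.X (3, 1)
  + MvPolynomial.X (0, 0) * MvPolynomial.X (1, 2) *
      MvPolynomial.X (2, 3) * MvPolynomial.X (3, 1)
  + MvPolynomial.X (0, 3) * MvPolynomial.X (1, 1) *
      MvPolynomial.X (2, 0) * MvPolynomial.X (3, 2)
  - MvPolynomial.X (0, 0) * MvPolynomial.X (1, 1) *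
      MvPolynomial.X (2, 3) * MvPolynomial.X (3, 2)
  - MvPolynomial.X (0, 1) * MvPolynomial.X (1, 2) *
      MvPolynomial.X (2, 0) * MvPolynomial.X (3, 3)
  + MvPolynomial.X (0, 1) * MvPolynomial.X (1, 0) *
      MvPolynomial.X (2, 2) * MvPolynomial.X (3, 3)

section MonomialRewriting

open MonoidAlgebra

variable {R M ι : Type*} [CommRing R] [CommMonoid M] [LinearOrder M]

/-- The span of the multiples `single a 1 * g k` all of whose leading monomials `a * m k` are
smaller than `n`, where `g k = single (m k) 1 + t k`. -/
noncomputable def multiplesBelow (m : ι → M) (t : ι → MonoidAlgebra R M) (n : M) :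
    Submodule R (MonoidAlgebra R M) :=
  Submodule.span R {x | ∃ a k, a * m k < n ∧ x = single a 1 * (single (m k) 1 + t k)}

lemma single_mul_mem_supported_Iio [IsOrderedCancelMonoid M] {m : ι → M}
    {t : ι → MonoidAlgebra R M} {k : ι} (ht : t k ∈ supported R R (Set.Iio (m k))) (b : M)
    (c : R) : single b c * t k ∈ supported R R (Set.Iio (b * m k)) := by
  classical
  intro e he
  obtain ⟨e', he', rfl⟩ := Finset.mem_image.1 (support_coeff_single_mul_subset _ _ _ he)
  exact mul_lt_mul_right (ht he') b

variable [WellFoundedLT M]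

open Classical in
/-- The normal form of a monomial under the rewriting rules `m k ↦ -t k`. -/
noncomputable def monomialNF (m : ι → M) (t : ι → MonoidAlgebra R M) : M → MonoidAlgebra R M :=
  WellFounded.fix (wellFounded_lt (α := M)) fun a rec =>
    if h : ∃ q : M × ι, a = q.1 * m q.2 then
      -(single h.choose.1 1 * t h.choose.2).coeff.sum fun e c =>
        if he : e < a then c • rec e he else 0
    else single a 1

/-- The linear extension of `monomialNF`. -/
noncomputable def normalForm (m : ι → M) (t : ι → MonoidAlgebra R M) :
    MonoidAlgebra R M →ₗ[R] MonoidAlgebra R M :=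
  Finsupp.linearCombination R (monomialNF m t) ∘ₗ (coeffLinearEquiv R).toLinearMap

variable {m : ι → M} {t : ι → MonoidAlgebra R M}

lemma normalForm_single (a : M) (c : R) :
    normalForm m t (single a c) = c • monomialNF m t a := by
  simp [normalForm]

lemma monomialNF_of_not_dvd {a : M} (h : ∀ k, ¬ m k ∣ a) : monomialNF m t a = single a 1 := by
  rw [monomialNF, WellFounded.fix_eq, dif_neg]
  rintro ⟨q, hq⟩
  exact h q.2 ⟨q.1, by rw [hq, mul_comm]⟩

lemma normalForm_mem_span_of_forall {p : MonoidAlgebra R M} {s : Set M}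
    {V : Submodule R (MonoidAlgebra R M)} (hp : p ∈ supported R R s)
    (h : ∀ a ∈ s, single a 1 - monomialNF m t a ∈ V) : p - normalForm m t p ∈ V := by
  rw [supported_eq_span_single] at hp
  induction hp using Submodule.span_induction with
  | mem x hx =>
    obtain ⟨a, ha, rfl⟩ := hx
    simpa [normalForm_single] using h a ha
  | zero => simp
  | add x y _ _ hx hy => simpa [map_add, add_sub_add_comm] using V.add_mem hx hy
  | smul c x _ hx => simpa [smul_sub] using V.smul_mem c hx

lemma normalForm_eq_self {p : MonoidAlgebra R M}
    (hp : p ∈ supported R R {a | ∀ k, ¬ m k ∣ a}) : normalForm m t p = p := by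
  have := normalForm_mem_span_of_forall (m := m) (t := t) (V := ⊥) hp
    fun a ha => by simp [monomialNF_of_not_dvd ha]
  exact (sub_eq_zero.1 ((Submodule.mem_bot R).1 this)).symm

variable [IsOrderedCancelMonoid M]

lemma exists_monomialNF_eq (ht : ∀ k, t k ∈ supported R R (Set.Iio (m k))) {a : M}
    (h : ∃ k, m k ∣ a) :
    ∃ b k, a = b * m k ∧ monomialNF m t a = -normalForm m t (single b 1 * t k) := by
  classical
  have h' : ∃ q : M × ι, a = q.1 * m q.2 := by
    obtain ⟨k, b, rfl⟩ := h
    exact ⟨(b, k), mul_comm _ _⟩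
  refine ⟨h'.choose.1, h'.choose.2, h'.choose_spec, ?_⟩
  rw [monomialNF, WellFounded.fix_eq, dif_pos h']
  simp only [normalForm, LinearMap.comp_apply, Finsupp.linearCombination_apply]
  congr 1
  refine Finsupp.sum_congr fun e he => ?_
  have := single_mul_mem_supported_Iio (ht h'.choose.2) h'.choose.1 1 he
  rw [← h'.choose_spec] at this
  rw [dif_pos (Set.mem_Iio.1 this)]
  rfl

/-- An element is congruent to its normal form. -/
lemma sub_normalForm_mem (ht : ∀ k, t k ∈ supported R R (Set.Iio (m k)))
    (p : MonoidAlgebra R M) :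
    p - normalForm m t p ∈ Ideal.span (Set.range fun k => single (m k) 1 + t k) := by
  set J := Ideal.span (Set.range fun k => single (m k) 1 + t k)
  refine normalForm_mem_span_of_forall (s := Set.univ) (V := J.restrictScalars R)
    (fun _ _ => trivial) fun a _ => ?_
  induction a using WellFoundedLT.induction with
  | ind a ih =>
  by_cases h : ∃ k, m k ∣ a
  · obtain ⟨b, k, rfl, hk⟩ := exists_monomialNF_eq ht h
    have h1 := normalForm_mem_span_of_forall (m := m) (t := t) (V := J.restrictScalars R)
      (single_mul_mem_supported_Iio (ht k) b 1) fun e he => ih e he trivial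
    have h2 : single b 1 * (single (m k) 1 + t k) ∈ J :=
      J.mul_mem_left _ (Ideal.subset_span ⟨k, rfl⟩)
    have h3 := J.sub_mem h2 h1
    rw [hk, Submodule.restrictScalars_mem]
    convert h3 using 1
    rw [mul_add, single_mul_single, one_mul]
    abel
  · push Not at h
    simp [monomialNF_of_not_dvd h]

/-- A normal form is a combination of monomials divisible by no leading monomial. -/
lemma normalForm_mem_supported (ht : ∀ k, t k ∈ supported R R (Set.Iio (m k)))
    (p : MonoidAlgebra R M) : normalForm m t p ∈ supported R R {a | ∀ k, ¬ m k ∣ a} := by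
  have key (s : Set M) (p : MonoidAlgebra R M) (hp : p ∈ supported R R s)
      (h : ∀ a ∈ s, monomialNF m t a ∈ supported R R {a | ∀ k, ¬ m k ∣ a}) :
      normalForm m t p ∈ supported R R {a | ∀ k, ¬ m k ∣ a} :=
    Submodule.sum_mem _ fun a ha => Submodule.smul_mem _ _ (h a (hp ha))
  refine key Set.univ p (fun _ _ => trivial) fun a _ => ?_
  induction a using WellFoundedLT.induction with
  | ind a ih =>
  by_cases h : ∃ k, m k ∣ a
  · obtain ⟨b, k, rfl, hk⟩ := exists_monomialNF_eq ht h
    rw [hk]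
    exact Submodule.neg_mem _ (key _ _ (single_mul_mem_supported_Iio (ht k) b 1)
      fun e he => ih e he trivial)
  · push Not at h
    rw [monomialNF_of_not_dvd h, supported_eq_span_single]
    exact Submodule.subset_span ⟨a, h, rfl⟩

/-- Buchberger's criterion: if all S-polynomials have standard representations, normal forms
vanish on the ideal. -/
lemma normalForm_eq_zero (ht : ∀ k, t k ∈ supported R R (Set.Iio (m k)))
    (hS : ∀ i j a b, a * m i = b * m j →
      single a 1 * t i - single b 1 * t j ∈ multiplesBelow m t (a * m i))
    {p : MonoidAlgebra R M} (hp : p ∈ Ideal.span (Set.range fun k => single (m k) 1 + t k)) :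
    normalForm m t p = 0 := by
  have key (n : M) : ∀ a k, a * m k = n →
      normalForm m t (single a 1 * (single (m k) 1 + t k)) = 0 := by
    induction n using WellFoundedLT.induction with
    | ind n ih =>
    rintro a k rfl
    obtain ⟨b, j, hb, hj⟩ := exists_monomialNF_eq ht (a := a * m k) ⟨k, Dvd.intro_left a rfl⟩
    have hle : multiplesBelow m t (a * m k) ≤ LinearMap.ker (normalForm m t) := by
      refine Submodule.span_le.2 ?_
      rintro _ ⟨c, i, hc, rfl⟩
      exact ih _ hc c i rfl
    have h0 := hle (hS k j a b hb)
    rw [LinearMap.mem_ker, map_sub, sub_eq_zero] at h0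
    rw [mul_add, single_mul_single, one_mul, map_add, normalForm_single, one_smul, hj, h0,
      neg_add_cancel]
  suffices ∀ q, normalForm m t (q * p) = 0 by simpa using this 1
  induction hp using Submodule.span_induction with
  | mem x hx =>
    obtain ⟨k, rfl⟩ := hx
    intro q
    induction q using MonoidAlgebra.induction_linear with
    | zero => simp
    | add x y hx hy => rw [add_mul, map_add, hx, hy, add_zero]
    | single a c =>
      rw [show single a c = c • single a (1 : R) by simp, smul_mul_assoc, map_smul, key _ a k rfl,
        smul_zero]
  | zero => simp
  | add x y _ _ hx hy => intro q; rw [mul_add, map_add, hx, hy, add_zero]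
  | smul c x _ hx => intro q; rw [smul_eq_mul, ← mul_assoc, hx]

/-- A monomial coprime to all leading monomials of a Gröbner basis is a nonzerodivisor modulo the
ideal. -/
lemma mem_span_of_single_mul_mem (ht : ∀ k, t k ∈ supported R R (Set.Iio (m k)))
    (hS : ∀ i j a b, a * m i = b * m j →
      single a 1 * t i - single b 1 * t j ∈ multiplesBelow m t (a * m i))
    {y : M} (hy : ∀ k a, m k ∣ y * a → m k ∣ a) {p : MonoidAlgebra R M}
    (hp : single y 1 * p ∈ Ideal.span (Set.range fun k => single (m k) 1 + t k)) :
    p ∈ Ideal.span (Set.range fun k => single (m k) 1 + t k) := by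
  classical
  have hsub := sub_normalForm_mem ht p
  set r := normalForm m t p
  have hsup : r ∈ supported R R {a | ∀ k, ¬ m k ∣ a} := normalForm_mem_supported ht p
  have h1 : single y 1 * r ∈ Ideal.span (Set.range fun k => single (m k) 1 + t k) := by
    have := Ideal.sub_mem _ hp (Ideal.mul_mem_left _ (single y 1) hsub)
    rwa [mul_sub, sub_sub_cancel] at this
  have h2 : single y 1 * r ∈ supported R R {a | ∀ k, ¬ m k ∣ a} := by
    intro e he k hk
    obtain ⟨e', he', rfl⟩ := Finset.mem_image.1 (support_coeff_single_mul_subset _ _ _ he)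
    exact hsup he' k (hy k e' hk)
  have h3 := normalForm_eq_zero ht hS h1
  rw [normalForm_eq_self h2] at h3
  have h4 : r = 0 := by
    ext a
    have := congrArg (fun q => q.coeff (y * a)) h3
    simpa [coeff_single_mul_eq_mul_coeff (m := y) (m₁ := y * a) a] using this
  rwa [h4, sub_zero] at hsub

end MonomialRewriting

section SPairs

open MonoidAlgebra

variable {R M ι : Type*} [CommRing R] [CommMonoid M] [LinearOrder M]

/-- All S-polynomials of the `i`-th and `j`-th generator have a standard representation. -/
def HasStandardSPairs (m : ι → M) (t : ι → MonoidAlgebra R M) (i j : ι) : Prop :=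
  ∀ a b, a * m i = b * m j →
    single a 1 * t i - single b 1 * t j ∈ multiplesBelow m t (a * m i)

variable {m : ι → M} {t : ι → MonoidAlgebra R M} {i j k : ι}

lemma HasStandardSPairs.symm (h : HasStandardSPairs m t i j) : HasStandardSPairs m t j i := by
  intro a b hab
  rw [← neg_sub, hab]
  exact Submodule.neg_mem _ (h b a hab.symm)

/-- Buchberger's chain criterion. -/
lemma HasStandardSPairs.trans (hik : HasStandardSPairs m t i k) (hkj : HasStandardSPairs m t k j)
    (h : ∀ a b, a * m i = b * m j → m k ∣ a * m i) : HasStandardSPairs m t i j := by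
  intro a b hab
  obtain ⟨c, hc⟩ := h a b hab
  rw [mul_comm (m k)] at hc
  have h1 := hik a c hc
  have h2 := hkj c b (hc ▸ hab)
  rw [← hc] at h2
  simpa using Submodule.add_mem _ h1 h2

variable [IsOrderedCancelMonoid M]

lemma HasStandardSPairs.refl : HasStandardSPairs m t i i := by
  intro a b hab
  rw [mul_right_cancel hab, sub_self]
  exact Submodule.zero_mem _

lemma single_mul_mem_multiplesBelow {n : M} {p : MonoidAlgebra R M}
    (hp : p ∈ multiplesBelow m t n) (d : M) : single d 1 * p ∈ multiplesBelow m t (d * n) := by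
  induction hp using Submodule.span_induction with
  | mem x hx =>
    obtain ⟨a, k, hlt, rfl⟩ := hx
    refine Submodule.subset_span ⟨d * a, k, ?_, ?_⟩
    · rw [mul_assoc]
      exact mul_lt_mul_right hlt d
    · rw [← mul_assoc, single_mul_single, one_mul]
  | zero => simp
  | add x y _ _ hx hy => simpa [mul_add] using Submodule.add_mem _ hx hy
  | smul c x _ hx => simpa using Submodule.smul_mem _ c hx

/-- It suffices to find a standard representation at the least common multiple. -/
lemma hasStandardSPairs_of_lcm {u v : M}
    (h : ∀ a b, a * m i = b * m j → ∃ d, a = d * u ∧ b = d * v)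
    (huv : single u 1 * t i - single v 1 * t j ∈ multiplesBelow m t (u * m i)) :
    HasStandardSPairs m t i j := by
  intro a b hab
  obtain ⟨d, rfl, rfl⟩ := h a b hab
  have := single_mul_mem_multiplesBelow huv d
  rwa [mul_sub, ← mul_assoc (single d 1), ← mul_assoc (single d 1), single_mul_single,
    single_mul_single, one_mul, ← mul_assoc] at this

/-- Buchberger's product criterion. -/
lemma hasStandardSPairs_of_coprime (hi : t i ∈ supported R R (Set.Iio (m i)))
    (hj : t j ∈ supported R R (Set.Iio (m j)))
    (h : ∀ a b, a * m i = b * m j → ∃ d, a = d * m j ∧ b = d * m i) :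
    HasStandardSPairs m t i j := by
  refine hasStandardSPairs_of_lcm h ?_
  have key (i j : ι) (p : MonoidAlgebra R M) (hp : p ∈ supported R R (Set.Iio (m j))) :
      p * (single (m i) 1 + t i) ∈ multiplesBelow m t (m j * m i) := by
    rw [supported_eq_span_single] at hp
    induction hp using Submodule.span_induction with
    | mem x hx =>
      obtain ⟨a, ha, rfl⟩ := hx
      exact Submodule.subset_span ⟨a, i, mul_lt_mul_left ha _, rfl⟩
    | zero => simp
    | add x y _ _ hx hy => simpa [add_mul] using Submodule.add_mem _ hx hy
    | smul c x _ hx => simpa using Submodule.smul_mem _ c hx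
  have h1 := key j i _ hi
  have h2 := key i j _ hj
  rw [mul_comm (m i)] at h1
  convert Submodule.sub_mem _ h1 h2 using 1
  ring

end SPairs

section TermLists

/-- Sum of two lists of terms sorted by decreasing monomials. -/
def addTerms : List (ℤ × ℕ) → List (ℤ × ℕ) → List (ℤ × ℕ)
  | [], q => q
  | x :: p, q => insertTerm x p (addTerms p) q
where
  /-- Sum of `x :: p` and a list, where `r` adds `p` to a list. -/
  insertTerm (x : ℤ × ℕ) (p : List (ℤ × ℕ)) (r : List (ℤ × ℕ) → List (ℤ × ℕ)) :
      List (ℤ × ℕ) → List (ℤ × ℕ)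
    | [] => x :: p
    | y :: q => bif x.2.beq y.2 then (x.1 + y.1, x.2) :: r q
        else bif y.2.ble x.2 then x :: r (y :: q) else y :: insertTerm x p r q

/-- Product of a list of terms by a single term. -/
def scaleTerms (c : ℤ) (d : ℕ) (p : List (ℤ × ℕ)) : List (ℤ × ℕ) :=
  p.map fun q => (c * q.1, d * q.2)

/-- Whether the combination of terms `p` reduces to zero in at most `k` steps modulo the
polynomials with leading monomial `g.1` and tail `g.2`, for `g` in `G`, with all reduction steps at
monomials below `n`. -/
def reducesToZero (G : List (ℕ × List (ℤ × ℕ))) (n : ℕ) : (k : ℕ) → List (ℤ × ℕ) → Bool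
  | 0, _ => false
  | _ + 1, [] => true
  | k + 1, (c, a) :: p =>
    if c = 0 then reducesToZero G n k p else
      match G.find? fun g => (a % g.1).beq 0 with
      | none => false
      | some g => a.blt n && reducesToZero G n k (addTerms p (scaleTerms (-c) (a / g.1) g.2))

/-- The S-polynomial of two polynomials given by their leading monomials and tails. -/
def sPoly (g h : ℕ × List (ℤ × ℕ)) : List (ℤ × ℕ) :=
  addTerms (scaleTerms 1 (h.1 / g.1.gcd h.1) g.2) (scaleTerms (-1) (g.1 / g.1.gcd h.1) h.2)

/-- Whether the S-pairs in `todo` satisfy Buchberger's criterion, given that those in `known` do: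
each is treated by the product criterion, the chain criterion, or reduction to zero. -/
def checkSPairs (G : List (ℕ × List (ℤ × ℕ))) :
    (known todo : List (Fin G.length × Fin G.length)) → Bool
  | _, [] => true
  | known, p :: todo =>
    ((G.get p.1).1.gcd (G.get p.2).1 == 1 ||
      (List.finRange G.length).any (fun k =>
        ((G.get p.1).1.lcm (G.get p.2).1 % (G.get k).1 == 0) &&
          (known.contains (p.1, k) || known.contains (k, p.1)) &&
          (known.contains (p.2, k) || known.contains (k, p.2))) ||
      reducesToZero G ((G.get p.1).1.lcm (G.get p.2).1) 1000 (sPoly (G.get p.1) (G.get p.2))) &&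
    checkSPairs G (p :: known) todo

/-- Whether the polynomials in `todo` can be derived successively from those in `known`: the
certificate `(i, j, c)` says that `c` times the next polynomial plus the S-polynomial of the `i`-th
and the `j`-th known polynomial reduces to zero. -/
def checkDerivation : (known todo : List (ℕ × List (ℤ × ℕ))) → List (ℕ × ℕ × ℤ) → Bool
  | _, [], _ => true
  | known, g :: todo, (i, j, c) :: certs =>
    match known[i]?, known[j]? with
    | some g₁, some g₂ =>
      c * c == 1 &&
      reducesToZero known (g₁.1.lcm g₂.1) 1000
        (addTerms (scaleTerms c 1 ((1, g.1) :: g.2)) (sPoly g₁ g₂)) &&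
      checkDerivation (known ++ [g]) todo certs
    | _, _ => false
  | _, _, _ => false

variable (R : Type*) [CommRing R]

open MonoidAlgebra

/-- The monomial attached to a positive integer, extended by zero. -/
noncomputable def natMonomial (n : ℕ) : MonoidAlgebra R ℕ+ :=
  if h : 0 < n then single ⟨n, h⟩ 1 else 0

lemma natMonomial_coe (n : ℕ+) : natMonomial R n = single n 1 := dif_pos n.pos

lemma natMonomial_mul (a b : ℕ) : natMonomial R (a * b) = natMonomial R a * natMonomial R b := by
  rcases Nat.eq_zero_or_pos a with rfl | ha
  · simp [natMonomial]
  rcases Nat.eq_zero_or_pos b with rfl | hb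
  · simp [natMonomial]
  lift a to ℕ+ using ha
  lift b to ℕ+ using hb
  rw [← PNat.mul_coe, natMonomial_coe, natMonomial_coe, natMonomial_coe, single_mul_single, one_mul]

lemma natMonomial_one : natMonomial R 1 = 1 := natMonomial_coe R 1

/-- The element of the monoid algebra given by a list of terms. -/
noncomputable def evalTerms (p : List (ℤ × ℕ)) : MonoidAlgebra R ℕ+ :=
  (p.map fun q => (q.1 : MonoidAlgebra R ℕ+) * natMonomial R q.2).sum

/-- The polynomial with leading monomial `g.1` and tail `g.2`. -/
noncomputable def evalMonic (g : ℕ × List (ℤ × ℕ)) : MonoidAlgebra R ℕ+ :=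
  natMonomial R g.1 + evalTerms R g.2

@[simp]
lemma evalTerms_nil : evalTerms R [] = 0 := rfl

@[simp]
lemma evalTerms_cons (q : ℤ × ℕ) (p : List (ℤ × ℕ)) :
    evalTerms R (q :: p) = (q.1 : MonoidAlgebra R ℕ+) * natMonomial R q.2 + evalTerms R p := by
  simp [evalTerms]

lemma evalTerms_addTerms (p q : List (ℤ × ℕ)) :
    evalTerms R (addTerms p q) = evalTerms R p + evalTerms R q := by
  induction p generalizing q with
  | nil => simp [addTerms]
  | cons x p ih =>
    rw [addTerms]
    induction q with
    | nil => simp [addTerms.insertTerm]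
    | cons y q ihq =>
      rw [addTerms.insertTerm]
      rcases hxy : x.2.beq y.2 with _ | _
      · rcases y.2.ble x.2 with _ | _
        · simp only [cond_false, evalTerms_cons, ihq]
          ring
        · simp only [cond_false, cond_true, evalTerms_cons, ih]
          ring
      · have := Nat.eq_of_beq_eq_true hxy
        simp only [cond_true, evalTerms_cons, ih, this]
        push_cast
        ring

lemma evalTerms_scaleTerms (c : ℤ) (d : ℕ) (p : List (ℤ × ℕ)) :
    evalTerms R (scaleTerms c d p) = c * natMonomial R d * evalTerms R p := by
  induction p with
  | nil => simp [scaleTerms]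
  | cons x p ih =>
    rw [scaleTerms] at ih ⊢
    rw [List.map_cons, evalTerms_cons, ih, evalTerms_cons, natMonomial_mul]
    push_cast
    ring

lemma evalTerms_mem_of_reducesToZero {G : List (ℕ × List (ℤ × ℕ))} {n : ℕ}
    {V : Submodule R (MonoidAlgebra R ℕ+)}
    (hV : ∀ g ∈ G, ∀ a, a * g.1 < n → natMonomial R a * evalMonic R g ∈ V) {k : ℕ}
    {p : List (ℤ × ℕ)} (h : reducesToZero G n k p = true) : evalTerms R p ∈ V := by
  induction k generalizing p with
  | zero => simp [reducesToZero] at h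
  | succ k ih =>
    match p with
    | [] => simp
    | (c, a) :: p =>
      rw [reducesToZero] at h
      split_ifs at h with hc
      · simpa [hc] using ih h
      · split at h
        · simp at h
        · next g hg =>
          have hmem := List.mem_of_find?_eq_some hg
          have hdvd := Nat.eq_of_beq_eq_true (List.find?_some
            (p := fun g : ℕ × List (ℤ × ℕ) => (a % g.1).beq 0) hg)
          rw [Bool.and_eq_true, Nat.blt_eq] at h
          obtain ⟨hlt, h⟩ := h
          have ha : a / g.1 * g.1 = a := Nat.div_mul_cancel (Nat.dvd_of_mod_eq_zero hdvd)
          have h1 := ih h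
          have h2 := hV g hmem (a / g.1) (by rwa [ha])
          have h3 := V.add_mem h1 (zsmul_mem h2 c)
          rw [evalTerms_addTerms, evalTerms_scaleTerms] at h3
          convert h3 using 1
          rw [evalTerms_cons, evalMonic, zsmul_eq_mul]
          have hmul : natMonomial R a = natMonomial R (a / g.1) * natMonomial R g.1 := by
            rw [← natMonomial_mul, ha]
          rw [hmul]
          push_cast
          ring

lemma evalTerms_sPoly (g h : ℕ × List (ℤ × ℕ)) :
    evalTerms R (sPoly g h) = natMonomial R (h.1 / g.1.gcd h.1) * evalTerms R g.2 -
      natMonomial R (g.1 / g.1.gcd h.1) * evalTerms R h.2 := by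
  rw [sPoly, evalTerms_addTerms, evalTerms_scaleTerms, evalTerms_scaleTerms]
  push_cast
  ring

lemma evalMonic_mem_of_checkDerivation {J : Ideal (MonoidAlgebra R ℕ+)}
    {known todo : List (ℕ × List (ℤ × ℕ))} {certs : List (ℕ × ℕ × ℤ)}
    (h : checkDerivation known todo certs = true) (hJ : ∀ g ∈ known, evalMonic R g ∈ J) :
    ∀ g ∈ todo, evalMonic R g ∈ J := by
  induction todo generalizing known certs with
  | nil => simp
  | cons g todo ih =>
    rcases certs with _ | ⟨⟨i, j, c⟩, certs⟩
    · simp [checkDerivation] at h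
    rw [checkDerivation] at h
    split at h
    · next g₁ g₂ h₁ h₂ =>
      simp only [Bool.and_eq_true, beq_iff_eq] at h
      obtain ⟨⟨hc, hred⟩, hrest⟩ := h
      have hS : evalTerms R (sPoly g₁ g₂) ∈ J := by
        have := J.sub_mem (J.mul_mem_left (natMonomial R (g₂.1 / g₁.1.gcd g₂.1))
          (hJ g₁ (List.mem_of_getElem? h₁))) (J.mul_mem_left
          (natMonomial R (g₁.1 / g₁.1.gcd g₂.1)) (hJ g₂ (List.mem_of_getElem? h₂)))
        have hlead : g₂.1 / g₁.1.gcd g₂.1 * g₁.1 = g₁.1 / g₁.1.gcd g₂.1 * g₂.1 := by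
          rw [Nat.div_mul_right_comm (Nat.gcd_dvd_right ..),
            Nat.div_mul_right_comm (Nat.gcd_dvd_left ..), mul_comm]
        rw [evalTerms_sPoly]
        convert this using 1
        rw [evalMonic, evalMonic, mul_add, mul_add, ← natMonomial_mul, ← natMonomial_mul, hlead]
        ring
      have hmem := evalTerms_mem_of_reducesToZero R (V := J.restrictScalars R)
        (fun g hg a _ => J.mul_mem_left _ (hJ g hg)) hred
      rw [evalTerms_addTerms, evalTerms_scaleTerms, Submodule.restrictScalars_mem,
        Ideal.add_mem_iff_left _ hS, evalTerms_cons, natMonomial_one] at hmem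
      have hg : evalMonic R g ∈ J := by
        convert J.mul_mem_left (c : MonoidAlgebra R ℕ+) hmem using 1
        have hc' : (c : MonoidAlgebra R ℕ+) * c = 1 := by
          rw [← Int.cast_mul, hc, Int.cast_one]
        rw [evalMonic, Int.cast_one, one_mul, mul_one, ← mul_assoc, hc', one_mul]
      intro g' hg'
      rcases List.mem_cons.1 hg' with rfl | hg'
      · exact hg
      · refine ih hrest (fun g'' hg'' => ?_) g' hg'
        rcases List.mem_append.1 hg'' with hg'' | hg''
        · exact hJ g'' hg''
        · rwa [List.mem_singleton.1 hg'']
    · simp at h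

/-- Whether `g` is monic with leading monomial `g.1`, that is, the monomials of its tail are
positive and smaller. -/
def isMonicLead (g : ℕ × List (ℤ × ℕ)) : Bool :=
  (0).blt g.1 && g.2.all fun q => (0).blt q.2 && q.2.blt g.1

lemma evalTerms_mem_supported {p : List (ℤ × ℕ)} {s : Set ℕ+}
    (h : ∀ q ∈ p, ∀ n : ℕ+, (n : ℕ) = q.2 → n ∈ s) : evalTerms R p ∈ supported R R s := by
  induction p with
  | nil => simp
  | cons q p ih =>
    rw [evalTerms_cons, ← zsmul_eq_mul]
    refine add_mem (zsmul_mem ?_ _) (ih fun q' hq' => h q' (List.mem_cons_of_mem _ hq'))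
    rw [natMonomial]
    split_ifs with hpos
    · rw [supported_eq_span_single]
      exact Submodule.subset_span ⟨_, h q List.mem_cons_self _ rfl, rfl⟩
    · exact zero_mem _

/-- The leading monomials of a list of polynomials. -/
def leadMonomial (G : List (ℕ × List (ℤ × ℕ))) (i : Fin G.length) : ℕ+ :=
  (G.get i).1.toPNat'

/-- The tails of a list of polynomials. -/
noncomputable def tailTerms (G : List (ℕ × List (ℤ × ℕ))) (i : Fin G.length) :
    MonoidAlgebra R ℕ+ :=
  evalTerms R (G.get i).2

section

variable {G : List (ℕ × List (ℤ × ℕ))}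

lemma coe_leadMonomial (hG : G.all isMonicLead = true) (i : Fin G.length) :
    (leadMonomial G i : ℕ) = (G.get i).1 := by
  have := List.all_eq_true.1 hG _ (G.get_mem i)
  rw [isMonicLead, Bool.and_eq_true, Nat.blt_eq] at this
  exact PNat.toPNat'_coe this.1

lemma single_leadMonomial_add_tailTerms (hG : G.all isMonicLead = true) (i : Fin G.length) :
    single (leadMonomial G i) 1 + tailTerms R G i = evalMonic R (G.get i) := by
  rw [evalMonic, tailTerms, ← coe_leadMonomial hG, natMonomial_coe]

lemma tailTerms_mem_supported (hG : G.all isMonicLead = true) (i : Fin G.length) :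
    tailTerms R G i ∈ supported R R (Set.Iio (leadMonomial G i)) := by
  have := List.all_eq_true.1 hG _ (G.get_mem i)
  simp only [isMonicLead, Bool.and_eq_true, Nat.blt_eq, List.all_eq_true] at this
  refine evalTerms_mem_supported R fun q hq n hn => ?_
  rw [Set.mem_Iio, ← PNat.coe_lt_coe, coe_leadMonomial hG, hn]
  exact (this.2 q hq).2

lemma exists_eq_mul_div_gcd {a b m n : ℕ+} (h : a * m = b * n) {g u v : ℕ}
    (hg : g = Nat.gcd m n) (hu : u = n / g) (hv : v = m / g) :
    ∃ d : ℕ+, (a : ℕ) = d * u ∧ (b : ℕ) = d * v := by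
  have hgpos : 0 < g := hg ▸ Nat.gcd_pos_of_pos_left _ m.pos
  have hm : (m : ℕ) = v * g := by rw [hv, Nat.div_mul_cancel (hg ▸ Nat.gcd_dvd_left ..)]
  have hn : (n : ℕ) = u * g := by rw [hu, Nat.div_mul_cancel (hg ▸ Nat.gcd_dvd_right ..)]
  have hcop : Nat.Coprime u v := by
    rw [hu, hv, hg]
    exact (Nat.coprime_div_gcd_div_gcd (hg ▸ hgpos)).symm
  have hN : (a : ℕ) * m = b * n := by exact_mod_cast congrArg PNat.val h
  have heq : (a : ℕ) * v = b * u := by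
    rw [hm, hn, ← mul_assoc, ← mul_assoc] at hN
    exact Nat.eq_of_mul_eq_mul_right hgpos hN
  obtain ⟨d, hd⟩ : u ∣ a := hcop.dvd_of_dvd_mul_right (heq ▸ Dvd.intro_left _ rfl)
  have hupos : 0 < u := by
    rcases Nat.eq_zero_or_pos u with h0 | h0
    · simp [h0] at hn
    · exact h0
  have hdpos : 0 < d := by
    rcases Nat.eq_zero_or_pos d with h0 | h0
    · simp [h0] at hd
    · exact h0
  refine ⟨⟨d, hdpos⟩, by rw [hd, PNat.mk_coe, mul_comm], ?_⟩
  rw [hd] at heq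
  exact Nat.eq_of_mul_eq_mul_right hupos (by rw [PNat.mk_coe, ← heq]; ring)

lemma hasStandardSPairs_of_checkSPairs (hG : G.all isMonicLead = true)
    {known todo : List (Fin G.length × Fin G.length)} (h : checkSPairs G known todo = true)
    (hknown : ∀ p ∈ known, HasStandardSPairs (leadMonomial G) (tailTerms R G) p.1 p.2) :
    ∀ p ∈ todo, HasStandardSPairs (leadMonomial G) (tailTerms R G) p.1 p.2 := by
  induction todo generalizing known with
  | nil => simp
  | cons p todo ih =>
    rw [checkSPairs, Bool.and_eq_true] at h
    obtain ⟨hp, h⟩ := h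
    suffices hp' : HasStandardSPairs (leadMonomial G) (tailTerms R G) p.1 p.2 from
      List.forall_mem_cons.2 ⟨hp', ih h (List.forall_mem_cons.2 ⟨hp', hknown⟩)⟩
    have hk (i j : Fin G.length) (hij : known.contains (i, j) || known.contains (j, i)) :
        HasStandardSPairs (leadMonomial G) (tailTerms R G) i j := by
      rw [Bool.or_eq_true, List.contains_iff_mem, List.contains_iff_mem] at hij
      exact hij.elim (hknown _) fun hij => (hknown _ hij).symm
    simp only [Bool.or_eq_true, List.any_eq_true, beq_iff_eq, Bool.and_eq_true] at hp
    rcases hp with (hcop | ⟨k, -, ⟨hk0, h1⟩, h2⟩) | hred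
    · refine hasStandardSPairs_of_coprime (tailTerms_mem_supported R hG _)
        (tailTerms_mem_supported R hG _) fun a b hab => ?_
      obtain ⟨d, hd⟩ := exists_eq_mul_div_gcd hab rfl rfl rfl
      rw [coe_leadMonomial hG, coe_leadMonomial hG, hcop, Nat.div_one, Nat.div_one] at hd
      simp only [← coe_leadMonomial hG, ← PNat.mul_coe, PNat.coe_inj] at hd
      exact ⟨d, hd⟩
    · refine (hk p.1 k (by simpa using h1)).trans (hk p.2 k (by simpa using h2)).symm
        fun a b hab => ?_
      rw [PNat.dvd_iff, coe_leadMonomial hG]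
      refine (Nat.dvd_of_mod_eq_zero hk0).trans (Nat.lcm_dvd ?_ ?_)
      · rw [PNat.mul_coe, coe_leadMonomial hG]
        exact Dvd.intro_left _ rfl
      · rw [hab, PNat.mul_coe, coe_leadMonomial hG]
        exact Dvd.intro_left _ rfl
    · have hpos (i : Fin G.length) : 0 < (G.get i).1 := coe_leadMonomial hG i ▸ PNat.pos _
      obtain ⟨u, hu⟩ : ∃ u : ℕ+, (u : ℕ) = (G.get p.2).1 / (G.get p.1).1.gcd (G.get p.2).1 :=
        ⟨⟨_, Nat.div_pos (Nat.gcd_le_right _ (hpos p.2)) (Nat.gcd_pos_of_pos_left _ (hpos p.1))⟩,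
          rfl⟩
      obtain ⟨v, hv⟩ : ∃ v : ℕ+, (v : ℕ) = (G.get p.1).1 / (G.get p.1).1.gcd (G.get p.2).1 :=
        ⟨⟨_, Nat.div_pos (Nat.gcd_le_left _ (hpos p.1)) (Nat.gcd_pos_of_pos_left _ (hpos p.1))⟩,
          rfl⟩
      refine hasStandardSPairs_of_lcm (u := u) (v := v) (fun a b hab => ?_) ?_
      · obtain ⟨d, hd⟩ := exists_eq_mul_div_gcd hab rfl rfl rfl
        simp only [coe_leadMonomial hG, ← hu, ← hv, ← PNat.mul_coe, PNat.coe_inj] at hd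
        exact ⟨d, hd⟩
      · have := evalTerms_mem_of_reducesToZero R (V := multiplesBelow (leadMonomial G)
          (tailTerms R G) (u * leadMonomial G p.1)) (fun g hg a ha => ?_) hred
        · rwa [evalTerms_sPoly, ← hu, ← hv, natMonomial_coe, natMonomial_coe] at this
        · rcases Nat.eq_zero_or_pos a with rfl | ha0
          · simp [natMonomial]
          obtain ⟨k, rfl⟩ := List.get_of_mem hg
          lift a to ℕ+ using ha0
          rw [natMonomial_coe, ← single_leadMonomial_add_tailTerms R hG]
          refine Submodule.subset_span ⟨a, k, ?_, rfl⟩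
          rw [← PNat.coe_lt_coe, PNat.mul_coe, PNat.mul_coe, coe_leadMonomial hG,
            coe_leadMonomial hG, hu]
          convert ha using 1
          rw [Nat.lcm, Nat.div_mul_right_comm (Nat.gcd_dvd_right ..), mul_comm]

/-- A monomial coprime to all leading monomials of a list of polynomials that passes the check of
Buchberger's criterion is a nonzerodivisor modulo their ideal. -/
lemma mem_span_of_natMonomial_mul_mem (hG : G.all isMonicLead = true)
    (hS : checkSPairs G [] ((List.finRange G.length).flatMap fun i =>
      ((List.finRange G.length).filter (i < ·)).map fun j => (i, j)) = true)
    {y : ℕ} (hy : 0 < y) (hcop : G.all (fun g => y.gcd g.1 == 1) = true) {p : MonoidAlgebra R ℕ+}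
    (hp : natMonomial R y * p ∈ Ideal.span {x | ∃ g ∈ G, evalMonic R g = x}) :
    p ∈ Ideal.span {x | ∃ g ∈ G, evalMonic R g = x} := by
  have hrange : {x | ∃ g ∈ G, evalMonic R g = x} =
      Set.range fun i => single (leadMonomial G i) 1 + tailTerms R G i := by
    ext x
    simp [single_leadMonomial_add_tailTerms R hG, List.exists_mem_iff_get]
  rw [hrange] at hp ⊢
  lift y to ℕ+ using hy
  rw [natMonomial_coe] at hp
  refine mem_span_of_single_mul_mem (tailTerms_mem_supported R hG) (fun i j => ?_)
    (fun k a hka => ?_) hp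
  · have key (i j : Fin G.length) (hij : i < j) :
        HasStandardSPairs (leadMonomial G) (tailTerms R G) i j :=
      hasStandardSPairs_of_checkSPairs R hG hS (by simp) (i, j) (by simpa using hij)
    rcases lt_trichotomy i j with hij | rfl | hij
    · exact key i j hij
    · exact HasStandardSPairs.refl
    · exact (key j i hij).symm
  · rw [PNat.dvd_iff, coe_leadMonomial hG] at hka ⊢
    rw [PNat.mul_coe] at hka
    have := beq_iff_eq.1 (List.all_eq_true.1 hcop _ (G.get_mem k))
    exact (Nat.Coprime.symm this).dvd_of_dvd_mul_left hka

end

end TermLists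

/-- A Gröbner basis, as leading monomials and tails. Its first six elements come from the four
principal minors, from `fpoly`, and from the minor represented by the prime `149`. -/
def groebnerTerms : List (ℕ × List (ℤ × ℕ)) :=
  [(62594503,
    [(-1, 57381377), (1, 43632989), (-1, 32632297), (-1, 26412131), (1, 18108017)]),
   (57855487,
    [(-1, 51004337), (1, 50422223), (-1, 33009763), (-1, 30161713), (1, 17407603)]),
   (62757623,
    [(-1, 53912273), (1, 48289561), (-1, 31192871), (-1, 28885991), (1, 16029151)]),
   (66793483,
    [(-1, 62056487), (1, 41107607), (-1, 30743611), (-1, 25535953), (1, 17743441)]),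
   (16812743461,
    [(-1, 16168374829), (1, 15983844691), (-1, 12784465777), (-1, 10324840301),
     (1, 7941681383)]),
   (61591261,
    [(-1, 46062953), (-1, 43399669), (1, 30155893), (1, 29754583), (-1, 27644387), (1, 149)]),
   (10464094871,
    [(-1, 10324840301), (1, 7941681383), (-1, 7738754383), (-1, 5518210151), (1, 5305648981)]),
   (19299567457,
    [(-1, 17844962363), (1, 15983844691), (-1, 12784465777), (-1, 10324840301),
     (1, 7941681383), (-1, 5518210151), (1, 5305648981)]),
   (5379241796821,
    [(-1, 4997745792569), (-1, 4137616000543), (1, 3800302442933), (1, 3554441241193),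
     (-1, 3513874298647), (1, 2874987488671), (-1, 2842175171809), (-1, 2764243119101),
     (1, 2101939617257), (1, 1577153956649), (-1, 1213118445467)]),
   (6057877137889,
    [(-1, 5553352374551), (-1, 4845312529483), (-1, 3913114474079), (1, 3635596267531),
     (1, 3321920584681), (2, 3009897244157), (-1, 2585668388507), (-1, 2091401647229),
     (-1, 2063569594799), (1, 1772720540249), (-1, 10333597)]),
   (5961974069743,
    [(-1, 5539150673627), (-1, 4768605734821), (-1, 3851165432273), (1, 3578040653797),
     (1, 3313425369637), (1, 2962247155859), (1, 2886555384859), (-1, 2544734324309),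
     (-1, 2058292386323), (-1, 2005698599323), (1, 1768187125973), (-1, 9910139)]),
   (1555368231371011,
    [(-1, 1537616767948669), (-1, 1495455527433641), (1, 1339488893647537),
     (1, 1137149332936037), (-1, 1030310755352371), (1, 853240290547109),
     (-1, 773075815804147), (-1, 656297078997647), (1, 587849409175879),
     (1, 571730659144331), (-1, 565205480296949)]),
   (2179060380828817,
    [(-1, 2154190700540143), (-1, 1694627159398469), (-1, 1407574389843887),
     (2, 1391509701886673), (1, 1288600101129233), (1, 1214095367754109),
     (1, 1094652452446459), (-1, 1070324225031059), (-1, 910975413985213),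
     (-1, 843603899416573), (-2, 832377348079663), (1, 578370361403311),
     (1, 480400248539053), (1, 468124991382053), (-1, 320944012509671), (1, 5481616577),
     (-1, 4168239389)]),
   (2405019112548599,
    [(-1, 2154190700540143), (-1, 1945284614205953), (-1, 1574486529792619),
     (2, 1391509701886673), (1, 1288600101129233), (1, 1273513547438893),
     (1, 1214095367754109), (-2, 1070324225031059), (1, 1042975144460059),
     (-1, 910975413985213), (-2, 843603899416573), (-1, 832377348079663),
     (2, 743705736680723), (-2, 715058230116313), (1, 578370361403311),
     (1, 480400248539053), (1, 468124991382053), (-1, 333802050244141), (1, 6292419149),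
     (-1, 4168239389)]),
   (1500292219298009,
    [(-1, 1393891446012301), (-1, 1216173444900233), (-1, 1153997780082347),
     (1, 1124510660639347), (-1, 982191732993829), (1, 912534663150281),
     (1, 833802066754931), (1, 801845598831659), (-1, 770958547780129),
     (2, 755484208283407), (-1, 649002765515257), (-1, 524941813454479),
     (-1, 517955968294549), (1, 444952855602499), (-1, 2593732847)]),
   (1255788215092423,
    [(-1, 1239076378086013), (1, 1191587284319557), (-1, 1161139672386557),
     (-1, 1107079875124073), (1, 1064435215515163), (-1, 780092814416417),
     (1, 750043679497027), (1, 715123497010903), (-1, 696850557203903),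
     (1, 670142920743767), (-1, 661224761512877)]),
   (679792502573935417,
    [(-1, 598883513956833619), (2, 549006047598809621), (-1, 510070520738331769),
     (-1, 508404107781062741), (-1, 466062136110159619), (-2, 422285573457982943),
     (1, 410591362421687233), (-2, 376395635892539447), (1, 349701645078489283),
     (1, 348559161188823287), (1, 315819488137661539), (1, 307749622553970539),
     (1, 293421559704581471), (2, 289516750580704901), (-1, 282118976380035901),
     (1, 255619936685574497), (-1, 216524166873474673), (-1, 210991509808537673),
     (-1, 201168265873627397), (1, 193419274662551407), (-1, 177615351383370209),
     (-2, 175251673522341179), (1, 162822819101489431), (1, 121772143350002363),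
     (1, 120151618338596153), (-1, 111630461634379117), (1, 2056090418099),
     (-1, 1884850805941), (1, 1449793325503), (-1, 1084273332419), (-1, 877595876737),
     (1, 601675080859)]),
   (669030615989651479,
    [(-1, 589402508458836253), (2, 540314658982469627), (-1, 501995525687065303),
     (-1, 500355493937563067), (-1, 464870265934701463), (-2, 415600313719861841),
     (1, 404091235312109071), (-2, 375433071680957819), (1, 348807345952290391),
     (1, 347667783759901499), (2, 302877596867100293), (3, 288776363508730577),
     (-1, 277652712901723987), (1, 251573183070499439), (-1, 210451936931164421),
     (-1, 207651274824761351), (-1, 200653814177669969), (1, 192924639619350739),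
     (-2, 174803498854873583), (-1, 172477240696129973), (1, 160245149142099097),
     (1, 121460732972253551), (1, 119844352162403381), (-1, 111344986785456409),
     (1, 2023540174013), (-1, 1880030638657), (1, 1390382591561), (-1, 1039841154853),
     (-1, 863702538319), (1, 600136404943)]),
   (160593793069599655561,
    [(-1, 156490277066553446561), (1, 126576178402092278567), (-1, 124891722028853931677),
     (1, 119257752448822675291), (-1, 117670688565977719321), (-1, 111587239070210161417),
     (1, 107288904384726092027), (-2, 105135448877343768341), (2, 101085636816852819871),
     (1, 90317171857399709891), (-1, 89115244783374971921), (-1, 82865240798661035227),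
     (1, 80674400295622877347), (1, 73052477585765661077), (1, 72080306415774322487),
     (-1, 70238499922335219487), (-1, 69303776735599136197), (1, 67912741935220305451),
     (-1, 66177425656706686451), (-1, 46560615857901893257), (1, 45982824595254437747),
     (-1, 40537615418711209597), (1, 39998147048675442607), (-1, 409436420238011),
     (1, 403987703139641), (1, 360951644187061), (-1, 347047805496191),
     (-1, 233158426815371), (1, 227200728716371)])]

/-- Certificates for deriving the Gröbner basis from its first six elements. -/
def groebnerCertificates : List (ℕ × ℕ × ℤ) :=
  [(0, 1, -1), (2, 3, -1), (0, 6, -1), (1, 4, 1), (2, 7, 1), (3, 8, 1), (4, 5, 1), (5, 7, -1),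
   (1, 5, 1), (9, 10, 1), (5, 9, -1), (5, 10, -1), (5, 15, 1)]

lemma all_isMonicLead_groebnerTerms : groebnerTerms.all isMonicLead = true := by
  decide +kernel

lemma checkSPairs_groebnerTerms :
    checkSPairs groebnerTerms [] ((List.finRange groebnerTerms.length).flatMap fun i =>
      ((List.finRange groebnerTerms.length).filter (i < ·)).map fun j => (i, j)) = true := by
  decide +kernel

lemma checkDerivation_groebnerTerms :
    checkDerivation (groebnerTerms.take 6) (groebnerTerms.drop 6) groebnerCertificates = true := by
  decide +kernel

section FourByFour

namespace Matrix

variable {R : Type*} [CommRing R] (A : Matrix (Fin 4) (Fin 4) R)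

/-- The minor of a `4 × 4` matrix obtained by deleting the `i`-th row and the `j`-th column. -/
def minorDeleting (i j : Fin 4) : R :=
  (A.submatrix i.succAbove j.succAbove).det

/-- The quartic form `fpoly` in the entries of an arbitrary matrix. -/
def quarticForm : R :=
  -A 0 3 * A 1 0 * A 2 2 * A 3 1 + A 0 0 * A 1 2 * A 2 3 * A 3 1 +
    A 0 3 * A 1 1 * A 2 0 * A 3 2 - A 0 0 * A 1 1 * A 2 3 * A 3 2 -
    A 0 1 * A 1 2 * A 2 0 * A 3 3 + A 0 1 * A 1 0 * A 2 2 * A 3 3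

lemma minorDeleting_eq {i j a b c d e f : Fin 4} (hi : i.succAbove = ![a, b, c])
    (hj : j.succAbove = ![d, e, f]) :
    A.minorDeleting i j =
      A a d * A b e * A c f - A a d * A b f * A c e - A a e * A b d * A c f +
        A a e * A b f * A c d + A a f * A b d * A c e - A a f * A b e * A c d := by
  rw [minorDeleting, det_fin_three, hi, hj]
  rfl

lemma succAbove_zero_four : (0 : Fin 4).succAbove = ![1, 2, 3] := by decide

lemma succAbove_one_four : (1 : Fin 4).succAbove = ![0, 2, 3] := by decide

lemma succAbove_two_four : (2 : Fin 4).succAbove = ![0, 1, 3] := by decide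

lemma succAbove_three_four : (3 : Fin 4).succAbove = ![0, 1, 2] := by decide

lemma minorDeleting_transpose (i j : Fin 4) : Aᵀ.minorDeleting i j = A.minorDeleting j i := by
  rw [minorDeleting, ← transpose_submatrix, det_transpose, minorDeleting]

lemma det_eq_sum_minorDeleting :
    A.det = A 0 0 * A.minorDeleting 0 0 - A 0 1 * A.minorDeleting 0 1 +
      A 0 2 * A.minorDeleting 0 2 - A 0 3 * A.minorDeleting 0 3 := by
  rw [det_succ_row_zero, Fin.sum_univ_four]
  simp only [minorDeleting, Fin.succAbove_zero]
  norm_num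
  ring

/-- Jacobi's identity for a complementary minor of size two. -/
lemma minorDeleting_mul_sub_eq_det_mul :
    A.minorDeleting 0 0 * A.minorDeleting 3 3 - A.minorDeleting 0 3 * A.minorDeleting 3 0 =
      A.det * (A 1 1 * A 2 2 - A 1 2 * A 2 1) := by
  rw [det_eq_sum_minorDeleting,
    minorDeleting_eq A succAbove_zero_four succAbove_zero_four,
    minorDeleting_eq A succAbove_zero_four succAbove_one_four,
    minorDeleting_eq A succAbove_zero_four succAbove_two_four,
    minorDeleting_eq A succAbove_zero_four succAbove_three_four,
    minorDeleting_eq A succAbove_three_four succAbove_zero_four,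
    minorDeleting_eq A succAbove_three_four succAbove_three_four]
  ring

lemma quarticForm_transpose :
    Aᵀ.quarticForm = -A.quarticForm + A 0 0 * A.minorDeleting 0 0 + A 1 1 * A.minorDeleting 1 1 -
      A 2 2 * A.minorDeleting 2 2 - A 3 3 * A.minorDeleting 3 3 := by
  rw [minorDeleting_eq A succAbove_zero_four succAbove_zero_four,
    minorDeleting_eq A succAbove_one_four succAbove_one_four,
    minorDeleting_eq A succAbove_two_four succAbove_two_four,
    minorDeleting_eq A succAbove_three_four succAbove_three_four]
  simp only [quarticForm, transpose_apply]
  ring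

lemma minorDeleting_zero_one_mul_quarticForm :
    A.minorDeleting 0 1 * A.quarticForm =
      (-A 0 0 * A 1 2 * A 2 0 * A 3 3 + A 0 0 * A 1 2 * A 2 3 * A 3 0 +
          A 0 2 * A 1 0 * A 2 0 * A 3 3 - A 0 2 * A 1 0 * A 2 3 * A 3 0) * A.minorDeleting 0 0 +
      (A 1 0 * A 1 2 * A 2 3 * A 3 1 - A 1 0 * A 1 3 * A 2 2 * A 3 1 -
          A 1 0 * A 1 1 * A 2 3 * A 3 2 + A 1 1 * A 1 3 * A 2 0 * A 3 2 +
          A 1 0 * A 1 1 * A 2 2 * A 3 3 - A 1 1 * A 1 2 * A 2 0 * A 3 3) * A.minorDeleting 1 1 +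
      (-A 1 0 * A 2 2 * A 2 2 * A 3 3 + A 1 0 * A 2 2 * A 2 3 * A 3 2 -
          A 1 2 * A 2 0 * A 2 3 * A 3 2 + A 1 2 * A 2 0 * A 2 2 * A 3 3) * A.minorDeleting 2 2 +
      (A 1 2 * A 2 0 * A 3 3 * A 3 3 - A 1 3 * A 2 0 * A 3 2 * A 3 3 -
          A 1 2 * A 2 3 * A 3 0 * A 3 3 + A 1 3 * A 2 3 * A 3 0 * A 3 2) * A.minorDeleting 3 3 := by
  rw [minorDeleting_eq A succAbove_zero_four succAbove_one_four,
    minorDeleting_eq A succAbove_zero_four succAbove_zero_four,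
    minorDeleting_eq A succAbove_one_four succAbove_one_four,
    minorDeleting_eq A succAbove_two_four succAbove_two_four,
    minorDeleting_eq A succAbove_three_four succAbove_three_four, quarticForm]
  ring

lemma minorDeleting_zero_two_mul_quarticForm :
    A.minorDeleting 0 2 * A.quarticForm =
      (-A 0 0 * A 1 0 * A 2 3 * A 3 1 + A 0 0 * A 1 1 * A 2 3 * A 3 0 +
          A 0 3 * A 1 0 * A 2 0 * A 3 1 - A 0 3 * A 1 1 * A 2 0 * A 3 0) * A.minorDeleting 0 0 +
      (-A 1 0 * A 1 3 * A 2 1 * A 3 1 + A 1 1 * A 1 3 * A 2 0 * A 3 1 -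
          A 1 1 * A 1 1 * A 2 0 * A 3 3 + A 1 0 * A 1 1 * A 2 1 * A 3 3) * A.minorDeleting 1 1 +
      (-A 1 0 * A 2 1 * A 2 2 * A 3 3 + A 1 0 * A 2 2 * A 2 3 * A 3 1 +
          A 1 2 * A 2 0 * A 2 1 * A 3 3 - A 1 2 * A 2 0 * A 2 3 * A 3 1) * A.minorDeleting 2 2 +
      (A 1 1 * A 2 0 * A 3 3 * A 3 3 - A 1 3 * A 2 0 * A 3 1 * A 3 3 -
          A 1 1 * A 2 3 * A 3 0 * A 3 3 + A 1 3 * A 2 3 * A 3 0 * A 3 1) * A.minorDeleting 3 3 := by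
  rw [minorDeleting_eq A succAbove_zero_four succAbove_two_four,
    minorDeleting_eq A succAbove_zero_four succAbove_zero_four,
    minorDeleting_eq A succAbove_one_four succAbove_one_four,
    minorDeleting_eq A succAbove_two_four succAbove_two_four,
    minorDeleting_eq A succAbove_three_four succAbove_three_four, quarticForm]
  ring

lemma minorDeleting_zero_three_mul_quarticForm :
    A.minorDeleting 0 3 * A.quarticForm =
      (-A 0 0 * A 1 0 * A 2 2 * A 3 1 + A 0 0 * A 1 2 * A 2 0 * A 3 1 +
          A 0 1 * A 1 0 * A 2 2 * A 3 0 - A 0 1 * A 1 2 * A 2 0 * A 3 0) * A.minorDeleting 0 0 +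
      (A 1 0 * A 1 1 * A 2 1 * A 3 2 - A 1 0 * A 1 2 * A 2 1 * A 3 1 -
          A 1 1 * A 1 1 * A 2 0 * A 3 2 + A 1 1 * A 1 2 * A 2 0 * A 3 1) * A.minorDeleting 1 1 +
      (-A 1 0 * A 2 1 * A 2 2 * A 3 2 + A 1 0 * A 2 2 * A 2 2 * A 3 1 +
          A 1 2 * A 2 0 * A 2 1 * A 3 2 - A 1 2 * A 2 0 * A 2 2 * A 3 1) * A.minorDeleting 2 2 +
      (A 1 1 * A 2 0 * A 3 2 * A 3 3 - A 1 1 * A 2 3 * A 3 0 * A 3 2 +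
          A 1 2 * A 2 3 * A 3 0 * A 3 1 - A 1 2 * A 2 0 * A 3 1 * A 3 3) * A.minorDeleting 3 3 := by
  rw [minorDeleting_eq A succAbove_zero_four succAbove_three_four,
    minorDeleting_eq A succAbove_zero_four succAbove_zero_four,
    minorDeleting_eq A succAbove_one_four succAbove_one_four,
    minorDeleting_eq A succAbove_two_four succAbove_two_four,
    minorDeleting_eq A succAbove_three_four succAbove_three_four, quarticForm]
  ring

lemma det_mul_quarticForm_mem {I : Ideal R} (hI : ∀ i, A.minorDeleting i i ∈ I) :
    A.det * A.quarticForm ∈ I := by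
  have h (c₀ c₁ c₂ c₃ : R) : c₀ * A.minorDeleting 0 0 + c₁ * A.minorDeleting 1 1 +
      c₂ * A.minorDeleting 2 2 + c₃ * A.minorDeleting 3 3 ∈ I :=
    I.add_mem (I.add_mem (I.add_mem (I.mul_mem_left _ (hI 0)) (I.mul_mem_left _ (hI 1)))
      (I.mul_mem_left _ (hI 2))) (I.mul_mem_left _ (hI 3))
  rw [det_eq_sum_minorDeleting, sub_mul, add_mul, sub_mul, mul_assoc, mul_assoc, mul_assoc,
    mul_assoc, minorDeleting_zero_one_mul_quarticForm, minorDeleting_zero_two_mul_quarticForm,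
    minorDeleting_zero_three_mul_quarticForm, mul_comm (A.minorDeleting 0 0)]
  exact I.sub_mem (I.add_mem (I.sub_mem (I.mul_mem_left _ (I.mul_mem_left _ (hI 0)))
    (I.mul_mem_left _ (h ..))) (I.mul_mem_left _ (h ..))) (I.mul_mem_left _ (h ..))

end Matrix

open MvPolynomial

variable (K : Type*) [Field K]

lemma prinMinorIdeal_four_three :
    prinMinorIdeal K 4 3 = Ideal.span (Set.range fun i => (genMat K 4).minorDeleting i i) := by
  rw [prinMinorIdeal]
  congr 1
  have key (s : Finset (Fin 4)) (i : Fin 4) (h : ∀ x, x ≠ i ↔ x ∈ s) :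
      (genMat K 4).minorDeleting i i = ((genMat K 4).submatrix
        (fun i : {x // x ∈ s} => (i : Fin 4)) (fun j : {x // x ∈ s} => (j : Fin 4))).det := by
    rw [← det_submatrix_equiv_self ((finSuccAboveEquiv i).trans (Equiv.subtypeEquivRight h))]
    rfl
  ext p
  constructor
  · rintro ⟨s, hs, rfl⟩
    have hcard : sᶜ.card = 1 := by rw [Finset.card_compl, hs, Fintype.card_fin]
    obtain ⟨i, hi⟩ := Finset.card_eq_one.1 hcard
    refine ⟨i, key s i fun x => ?_⟩
    rw [← not_iff_not, not_not, ← Finset.mem_compl, hi, Finset.mem_singleton]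
  · rintro ⟨i, rfl⟩
    exact ⟨{i}ᶜ, by simp [Finset.card_compl], key _ i (by simp)⟩

lemma quarticForm_genMat : (genMat K 4).quarticForm = fpoly K := rfl

lemma minorDeleting_mem_prinMinorIdeal (i : Fin 4) :
    (genMat K 4).minorDeleting i i ∈ prinMinorIdeal K 4 3 := by
  rw [prinMinorIdeal_four_three]
  exact Ideal.subset_span ⟨i, rfl⟩

lemma mem_Qideal_iff {n : ℕ} {p : MvPolynomial (Fin n × Fin n) K} :
    p ∈ Qideal K n ↔ ∃ k : ℕ, (genMat K n).det ^ k * p ∈ prinMinorIdeal K n (n - 1) := by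
  rw [Qideal, Ideal.mem_comap,
    IsLocalization.algebraMap_mem_map_algebraMap_iff (Submonoid.powers (genMat K n).det)]
  simp [Submonoid.mem_powers_iff]

/-- A ring homomorphism maps `P₃ + (f)` into an ideal as soon as it does so for the generators. -/
lemma map_mem_of_mem_prinMinorIdeal_sup {S : Type*} [CommRing S]
    (φ : MvPolynomial (Fin 4 × Fin 4) K →+* S) {I : Ideal S}
    (hM : ∀ i, φ ((genMat K 4).minorDeleting i i) ∈ I) (hf : φ (fpoly K) ∈ I)
    {p : MvPolynomial (Fin 4 × Fin 4) K}
    (hp : p ∈ prinMinorIdeal K 4 3 ⊔ Ideal.span {fpoly K}) : φ p ∈ I := by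
  suffices h : prinMinorIdeal K 4 3 ⊔ Ideal.span {fpoly K} ≤ I.comap φ from h hp
  rw [prinMinorIdeal_four_three, sup_le_iff, Ideal.span_le, Ideal.span_le]
  exact ⟨by rintro _ ⟨i, rfl⟩; exact hM i, by simpa using hf⟩

lemma rename_swap_minorDeleting (i j : Fin 4) :
    rename Prod.swap ((genMat K 4).minorDeleting i j) = (genMat K 4).minorDeleting j i := by
  rw [← minorDeleting_transpose, minorDeleting, minorDeleting, AlgHom.map_det]
  congr 1
  ext a b : 2
  simp [genMat]

/-- The ideal `P₃ + (f)` is invariant under transposition. -/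
lemma rename_swap_mem_prinMinorIdeal_sup {p : MvPolynomial (Fin 4 × Fin 4) K}
    (hp : p ∈ prinMinorIdeal K 4 3 ⊔ Ideal.span {fpoly K}) :
    rename Prod.swap p ∈ prinMinorIdeal K 4 3 ⊔ Ideal.span {fpoly K} := by
  have hM (i : Fin 4) := Ideal.mem_sup_left (T := Ideal.span {fpoly K})
    (minorDeleting_mem_prinMinorIdeal K i)
  have hf : fpoly K ∈ prinMinorIdeal K 4 3 ⊔ Ideal.span {fpoly K} :=
    Ideal.mem_sup_right (Ideal.mem_span_singleton_self _)
  refine map_mem_of_mem_prinMinorIdeal_sup K (rename Prod.swap).toRingHom (fun i => ?_) ?_ hp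
  · rw [AlgHom.toRingHom_eq_coe, RingHom.coe_coe, rename_swap_minorDeleting]
    exact hM i
  · have : rename Prod.swap (fpoly K) = (genMat K 4)ᵀ.quarticForm := by
      simp [fpoly, quarticForm, genMat]
    rw [AlgHom.toRingHom_eq_coe, RingHom.coe_coe, this, quarticForm_transpose, quarticForm_genMat]
    exact Ideal.sub_mem _ (Ideal.sub_mem _ (Ideal.add_mem _ (Ideal.add_mem _ (neg_mem hf)
      (Ideal.mul_mem_left _ _ (hM 0))) (Ideal.mul_mem_left _ _ (hM 1)))
      (Ideal.mul_mem_left _ _ (hM 2))) (Ideal.mul_mem_left _ _ (hM 3))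

/-- Distinct primes attached to the sixteen variables. The numerical order of their products is a
monomial order for which a Gröbner basis can be checked quickly. -/
def varPrime (v : Fin 4 × Fin 4) : ℕ :=
  !![293, 373, 251, 439; 541, 317, 307, 241; 223, 457, 331, 379; 347, 227, 521, 311] v.1 v.2

lemma varPrime_prime (v : Fin 4 × Fin 4) : (varPrime v).Prime := by
  obtain ⟨i, j⟩ := v
  fin_cases i <;> fin_cases j <;> norm_num [varPrime]

lemma varPrime_injective : Function.Injective varPrime := by
  decide

lemma varPrime_ne (v : Fin 4 × Fin 4) : varPrime v ≠ 149 := by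
  decide +revert

/-- The map sending each variable to the monomial given by its prime. -/
noncomputable def toPrimes : MvPolynomial (Fin 4 × Fin 4) K →ₐ[K] MonoidAlgebra K ℕ+ :=
  aeval fun v => natMonomial K (varPrime v)

/-- The map sending the prime of each variable to that variable, the prime `149` to the minor
obtained by deleting the last row and the first column, and the other primes to `1`. -/
noncomputable def ofPrimes : MonoidAlgebra K ℕ+ →ₐ[K] MvPolynomial (Fin 4 × Fin 4) K :=
  MonoidAlgebra.lift K _ ℕ+
    { toFun := fun n => (∏ v, X v ^ (n : ℕ).factorization (varPrime v)) *
        (genMat K 4).minorDeleting 3 0 ^ (n : ℕ).factorization 149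
      map_one' := by simp
      map_mul' := fun a b => by
        simp only [PNat.mul_coe, Nat.factorization_mul a.ne_zero b.ne_zero, Finsupp.add_apply,
          pow_add, Finset.prod_mul_distrib]
        ring }

lemma ofPrimes_natMonomial_prime {q : ℕ} (hq : q.Prime) :
    ofPrimes K (natMonomial K q) = (∏ v, X v ^ (if q = varPrime v then 1 else 0)) *
      (genMat K 4).minorDeleting 3 0 ^ (if q = 149 then 1 else 0) := by
  lift q to ℕ+ using hq.pos
  rw [natMonomial_coe, ofPrimes, MonoidAlgebra.lift_single]
  simp [hq.factorization, Finsupp.single_apply]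

lemma ofPrimes_toPrimes (p : MvPolynomial (Fin 4 × Fin 4) K) : ofPrimes K (toPrimes K p) = p := by
  suffices (ofPrimes K).comp (toPrimes K) = AlgHom.id K _ from DFunLike.congr_fun this p
  ext1 v
  rw [AlgHom.comp_apply, toPrimes, aeval_X, ofPrimes_natMonomial_prime K (varPrime_prime v)]
  simp [varPrime_injective.eq_iff, varPrime_ne]

lemma ofPrimes_natMonomial_minor :
    ofPrimes K (natMonomial K 149) = (genMat K 4).minorDeleting 3 0 := by
  rw [ofPrimes_natMonomial_prime K (by norm_num)]
  simp [fun v => (varPrime_ne v).symm]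

lemma toPrimes_genMat (i j : Fin 4) : toPrimes K (genMat K 4 i j) =
    natMonomial K (varPrime (i, j)) :=
  aeval_X ..

lemma toPrimes_minorDeleting (i j : Fin 4) :
    toPrimes K ((genMat K 4).minorDeleting i j) =
      (of fun i j => natMonomial K (varPrime (i, j))).minorDeleting i j := by
  rw [minorDeleting, minorDeleting, AlgHom.map_det]
  congr 1
  ext a b : 1
  exact toPrimes_genMat K _ _

lemma evalMonic_minorDeleting_zero :
    evalMonic K groebnerTerms[0] = -toPrimes K ((genMat K 4).minorDeleting 0 0) := by
  rw [toPrimes_minorDeleting, minorDeleting_eq _ succAbove_zero_four succAbove_zero_four]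
  simp only [of_apply, ← natMonomial_mul, varPrime, cons_val, Nat.reduceMul]
  simp [evalMonic, groebnerTerms]
  ring

lemma evalMonic_minorDeleting_one :
    evalMonic K groebnerTerms[1] = -toPrimes K ((genMat K 4).minorDeleting 1 1) := by
  rw [toPrimes_minorDeleting, minorDeleting_eq _ succAbove_one_four succAbove_one_four]
  simp only [of_apply, ← natMonomial_mul, varPrime, cons_val, Nat.reduceMul]
  simp [evalMonic, groebnerTerms]
  ring

lemma evalMonic_minorDeleting_two :
    evalMonic K groebnerTerms[2] = -toPrimes K ((genMat K 4).minorDeleting 2 2) := by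
  rw [toPrimes_minorDeleting, minorDeleting_eq _ succAbove_two_four succAbove_two_four]
  simp only [of_apply, ← natMonomial_mul, varPrime, cons_val, Nat.reduceMul]
  simp [evalMonic, groebnerTerms]
  ring

lemma evalMonic_minorDeleting_three :
    evalMonic K groebnerTerms[3] = -toPrimes K ((genMat K 4).minorDeleting 3 3) := by
  rw [toPrimes_minorDeleting, minorDeleting_eq _ succAbove_three_four succAbove_three_four]
  simp only [of_apply, ← natMonomial_mul, varPrime, cons_val, Nat.reduceMul]
  simp [evalMonic, groebnerTerms]
  ring

lemma evalMonic_minorDeleting_three_zero :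
    evalMonic K groebnerTerms[5] =
      natMonomial K 149 - toPrimes K ((genMat K 4).minorDeleting 3 0) := by
  rw [toPrimes_minorDeleting, minorDeleting_eq _ succAbove_three_four succAbove_zero_four]
  simp only [of_apply, ← natMonomial_mul, varPrime, cons_val, Nat.reduceMul]
  simp [evalMonic, groebnerTerms]
  ring

lemma evalMonic_fpoly :
    evalMonic K groebnerTerms[4] = toPrimes K (-fpoly K +
      genMat K 4 0 0 * (genMat K 4).minorDeleting 0 0 -
      genMat K 4 2 2 * (genMat K 4).minorDeleting 2 2) := by
  rw [← quarticForm_genMat, minorDeleting_eq _ succAbove_zero_four succAbove_zero_four,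
    minorDeleting_eq _ succAbove_two_four succAbove_two_four, quarticForm]
  simp only [map_add, map_sub, map_neg, map_mul, toPrimes_genMat]
  simp only [mul_add, mul_sub, neg_mul, ← natMonomial_mul, varPrime, of_apply, cons_val,
    Nat.reduceMul]
  simp [evalMonic, groebnerTerms]
  ring

/-- The ideal generated by the Gröbner basis. -/
noncomputable def groebnerIdeal : Ideal (MonoidAlgebra K ℕ+) :=
  Ideal.span {x | ∃ g ∈ groebnerTerms, evalMonic K g = x}

lemma evalMonic_mem_groebnerIdeal {k : ℕ} (hk : k < groebnerTerms.length) :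
    evalMonic K groebnerTerms[k] ∈ groebnerIdeal K :=
  Ideal.subset_span ⟨_, List.getElem_mem hk, rfl⟩

lemma toPrimes_mem_groebnerIdeal {p : MvPolynomial (Fin 4 × Fin 4) K}
    (hp : p ∈ prinMinorIdeal K 4 3 ⊔ Ideal.span {fpoly K}) : toPrimes K p ∈ groebnerIdeal K := by
  have hM (i : Fin 4) : toPrimes K ((genMat K 4).minorDeleting i i) ∈ groebnerIdeal K := by
    rw [← neg_mem_iff]
    fin_cases i
    · exact evalMonic_minorDeleting_zero K ▸ evalMonic_mem_groebnerIdeal K _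
    · exact evalMonic_minorDeleting_one K ▸ evalMonic_mem_groebnerIdeal K _
    · exact evalMonic_minorDeleting_two K ▸ evalMonic_mem_groebnerIdeal K _
    · exact evalMonic_minorDeleting_three K ▸ evalMonic_mem_groebnerIdeal K _
  refine map_mem_of_mem_prinMinorIdeal_sup K (toPrimes K).toRingHom hM ?_ hp
  have hf := evalMonic_fpoly K ▸ evalMonic_mem_groebnerIdeal K (k := 4) (by decide)
  rw [map_sub, map_add, map_mul, map_mul,
    Submodule.sub_mem_iff_left _ (Ideal.mul_mem_left _ _ (hM 2)),
    Ideal.add_mem_iff_left _ (Ideal.mul_mem_left _ _ (hM 0)), map_neg, neg_mem_iff] at hf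
  exact hf

lemma ofPrimes_mem_prinMinorIdeal_sup {p : MonoidAlgebra K ℕ+} (hp : p ∈ groebnerIdeal K) :
    ofPrimes K p ∈ prinMinorIdeal K 4 3 ⊔ Ideal.span {fpoly K} := by
  set J := prinMinorIdeal K 4 3 ⊔ Ideal.span {fpoly K}
  suffices h : groebnerIdeal K ≤ J.comap (ofPrimes K) from h hp
  have hM (i : Fin 4) : (genMat K 4).minorDeleting i i ∈ J :=
    Ideal.mem_sup_left (minorDeleting_mem_prinMinorIdeal K i)
  have hf : fpoly K ∈ J := Ideal.mem_sup_right (Ideal.mem_span_singleton_self _)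
  have hknown : ∀ g ∈ groebnerTerms.take 6, evalMonic K g ∈ J.comap (ofPrimes K) := by
    have htake : groebnerTerms.take 6 = [groebnerTerms[0], groebnerTerms[1], groebnerTerms[2],
      groebnerTerms[3], groebnerTerms[4], groebnerTerms[5]] := rfl
    simp only [htake, List.forall_mem_cons, Ideal.mem_comap, evalMonic_minorDeleting_zero,
      evalMonic_minorDeleting_one, evalMonic_minorDeleting_two, evalMonic_minorDeleting_three,
      evalMonic_fpoly, evalMonic_minorDeleting_three_zero, map_neg, map_sub (ofPrimes K),
      ofPrimes_toPrimes, ofPrimes_natMonomial_minor, neg_mem_iff, sub_self]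
    exact ⟨hM 0, hM 1, hM 2, hM 3, J.sub_mem (J.add_mem (neg_mem hf) (J.mul_mem_left _ (hM 0)))
      (J.mul_mem_left _ (hM 2)), J.zero_mem, by simp⟩
  rw [groebnerIdeal, Ideal.span_le]
  rintro _ ⟨g, hg, rfl⟩
  rw [← List.take_append_drop 6 groebnerTerms, List.mem_append] at hg
  exact hg.elim (hknown g)
    (evalMonic_mem_of_checkDerivation K checkDerivation_groebnerTerms hknown g)

lemma mem_of_minorDeleting_three_zero_mul_mem {p : MvPolynomial (Fin 4 × Fin 4) K}
    (hp : (genMat K 4).minorDeleting 3 0 * p ∈ prinMinorIdeal K 4 3 ⊔ Ideal.span {fpoly K}) :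
    p ∈ prinMinorIdeal K 4 3 ⊔ Ideal.span {fpoly K} := by
  rw [← ofPrimes_toPrimes K p]
  refine ofPrimes_mem_prinMinorIdeal_sup K (mem_span_of_natMonomial_mul_mem K
    all_isMonicLead_groebnerTerms checkSPairs_groebnerTerms (y := 149) (by norm_num)
    (by decide +kernel) ?_)
  have h := add_mem (toPrimes_mem_groebnerIdeal K hp) (Ideal.mul_mem_right (toPrimes K p) _
    (evalMonic_mem_groebnerIdeal K (k := 5) (by decide)))
  rwa [evalMonic_minorDeleting_three_zero, map_mul, sub_mul, add_sub_cancel] at h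

lemma mem_of_minorDeleting_zero_three_mul_mem {p : MvPolynomial (Fin 4 × Fin 4) K}
    (hp : (genMat K 4).minorDeleting 0 3 * p ∈ prinMinorIdeal K 4 3 ⊔ Ideal.span {fpoly K}) :
    p ∈ prinMinorIdeal K 4 3 ⊔ Ideal.span {fpoly K} := by
  have h := rename_swap_mem_prinMinorIdeal_sup K hp
  rw [map_mul, rename_swap_minorDeleting] at h
  have h' := rename_swap_mem_prinMinorIdeal_sup K (mem_of_minorDeleting_three_zero_mul_mem K h)
  rwa [rename_rename, Prod.swap_swap_eq, rename_id_apply] at h'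

/-- The determinant of the generic matrix is a nonzerodivisor modulo `P₃ + (f)`. -/
lemma mem_of_det_mul_mem {p : MvPolynomial (Fin 4 × Fin 4) K}
    (hp : (genMat K 4).det * p ∈ prinMinorIdeal K 4 3 ⊔ Ideal.span {fpoly K}) :
    p ∈ prinMinorIdeal K 4 3 ⊔ Ideal.span {fpoly K} := by
  refine mem_of_minorDeleting_three_zero_mul_mem K (mem_of_minorDeleting_zero_three_mul_mem K ?_)
  have hM : (genMat K 4).minorDeleting 3 3 ∈ prinMinorIdeal K 4 3 ⊔ Ideal.span {fpoly K} :=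
    Ideal.mem_sup_left (minorDeleting_mem_prinMinorIdeal K 3)
  convert Ideal.sub_mem _ (Ideal.mul_mem_left _ ((genMat K 4).minorDeleting 0 0 * p) hM)
    (Ideal.mul_mem_left _ (genMat K 4 1 1 * genMat K 4 2 2 - genMat K 4 1 2 * genMat K 4 2 1) hp)
    using 1
  linear_combination -p * (genMat K 4).minorDeleting_mul_sub_eq_det_mul

end FourByFour

/-- For `n = 4`, `Q₃ = P₃ + (f)`: the ideal `Q₃` is generated by the four principal
3-minors of `X` together with the degree-4 polynomial `f`. -/
theorem Qideal_eq_prinMinorIdeal_sup_f (K : Type*) [Field K] [IsAlgClosed K] :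
    Qideal K 4 = prinMinorIdeal K 4 3 ⊔ Ideal.span {fpoly K} := by
  refine le_antisymm (fun p hp => ?_) (sup_le (fun p hp => ?_) ?_)
  · obtain ⟨k, hk⟩ := (mem_Qideal_iff K).1 hp
    replace hk := Ideal.mem_sup_left (T := Ideal.span {fpoly K}) hk
    induction k with
    | zero => simpa using hk
    | succ k ih => exact ih (mem_of_det_mul_mem K (by rwa [← mul_assoc, ← pow_succ']))
  · exact (mem_Qideal_iff K).2 ⟨0, by simpa using hp⟩
  · rw [Ideal.span_le, Set.singleton_subset_iff, SetLike.mem_coe, mem_Qideal_iff]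
    refine ⟨1, ?_⟩
    rw [pow_one, ← quarticForm_genMat]
    exact det_mul_quarticForm_mem _ (minorDeleting_mem_prinMinorIdeal K)
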